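/- arXiv:2108.08817 — 3 statements merged into one kernel-verified Lean document; each statement's English description precedes it below -/
import Mathlib

section
/- For every integer d ≥ 1, the set M_d^* = {F ∈ ℂ[x,y] : deg_y F < d} (equivalently, M_d^* = {f(y,x) : f ∈ M_d}, the image of M_d under swapping the variables) is an indecomposable L-module of order d in ℂ[x,y]. -/
open Polynomial
open scoped Pointwise BigOperators

noncomputable section

/-- `ℂ[x,y]` as `ℂ[x][y]`: outer variable is `y`, inner variable is `x`. -/
abbrev R2 : Type := Polynomial (Polynomial ℂ)

/-- The polynomial `(x,y) ↦ F(x+a, y+b)`. -/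
noncomputable def polyTranslate (a b : ℂ) (F : R2) : R2 :=
  (F.map (aeval (X + C a) : Polynomial ℂ →ₐ[ℂ] Polynomial ℂ).toRingHom).comp (X + C (C b))

/-- A submodule of `ℂ[x,y]`: a translation invariant `ℂ`-linear subspace. -/
def IsSubmodule (M : Set R2) : Prop :=
  (0 ∈ M) ∧ (∀ F ∈ M, ∀ G ∈ M, F + G ∈ M) ∧ (∀ (c : ℂ), ∀ F ∈ M, c • F ∈ M) ∧
    (∀ F ∈ M, ∀ a b : ℂ, polyTranslate a b F ∈ M)

/-- The `n`-th coordinate polynomial `[F]_n ∈ ℂ[x]`, so that `F = ∑ [F]_n · yⁿ/n!`. -/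
noncomputable def coordPoly (F : R2) (n : ℕ) : Polynomial ℂ := (n.factorial : ℂ) • F.coeff n

/-- An L-module of order `s`. -/
def IsLModule (s : ℕ) (M : Set R2) : Prop :=
  IsSubmodule M ∧ ∀ F ∈ M, (∀ n < s, coordPoly F n = 0) → F = 0

/-- `M_d = {F : deg_x F < d}`. -/
def Md (d : ℕ) : Set R2 := {F | ∀ n, (coordPoly F n).degree < (d : WithBot ℕ)}

/-- The map `L(f_1,…,f_s) = ∑_{i=1}^{s} ∑_{j=1}^{∞} a_{i,j} f_i^{(j)}`, where `a i j`
represents `a_{i+1, j+1}`. -/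
noncomputable def Lmap {s : ℕ} (a : Fin s → ℕ → ℂ) (f : Fin s → Polynomial ℂ) :
    Polynomial ℂ :=
  ∑ i : Fin s, ∑ᶠ j : ℕ, a i (j + 1) • (Polynomial.derivative^[j + 1] (f i))

/-- `V_{A,s} = {([F]_0, …, [F]_{s−1}) : F ∈ A}`. -/
def Vset (A : Set R2) (s : ℕ) : Set (Fin s → Polynomial ℂ) :=
  {φ | ∃ F ∈ A, ∀ i : Fin s, φ i = coordPoly F i}

/-- A submodule is decomposable if it is the sum of finitely many proper submodules. -/
def Decomposable (M : Set R2) : Prop :=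
  ∃ (k : ℕ) (A : Fin k → Set R2), 0 < k ∧ (∀ i, IsSubmodule (A i) ∧ A i ⊂ M) ∧
    M = ∑ i : Fin k, A i

/-- The difference operator `f ↦ f(X + 1) - f(X)` lowers the degree by one. -/
lemma degree_taylor_one_sub_lt {R : Type*} [CommRing R] {f : R[X]} {n : ℕ}
    (hf : f.degree < ((n + 2 : ℕ) : WithBot ℕ)) :
    (taylor 1 f - f).degree < ((n + 1 : ℕ) : WithBot ℕ) := by
  rw [degree_lt_iff_coeff_zero] at hf ⊢
  intro m hm
  have hconst : hasseDeriv m f = C (f.coeff m) := by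
    ext i
    rw [hasseDeriv_coeff, coeff_C]
    split_ifs with hi
    · simp [hi]
    · rw [hf (i + m) (by omega), mul_zero]
  rw [coeff_sub, taylor_coeff, hconst, eval_C, sub_self]

lemma coeff_taylor_one_sub {R : Type*} [CommRing R] {f : R[X]} {n : ℕ}
    (hf : f.degree < ((n + 2 : ℕ) : WithBot ℕ)) :
    (taylor 1 f - f).coeff n = (n + 1) * f.coeff (n + 1) := by
  rw [degree_lt_iff_coeff_zero] at hf
  have hlin : hasseDeriv n f = C (f.coeff n) + C ((n + 1) * f.coeff (n + 1)) * X := by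
    ext i
    rw [hasseDeriv_coeff, coeff_add, coeff_C, coeff_C_mul, coeff_X]
    rcases i with _ | _ | i
    · simp
    · simp [add_comm 1 n]
    · rw [hf (i + 1 + 1 + n) (by omega)]
      simp
  rw [coeff_sub, taylor_coeff, hlin]
  simp

/-- An additive group of polynomials that is stable under `X ↦ X + 1` and whose elements of
degree at most `n` have arbitrary `n`-th coefficient contains all polynomials of degree at
most `n`. -/
lemma mem_of_degree_lt_of_coeff_surjective {R : Type*} [CommRing R] [Algebra ℚ R]
    (S : AddSubgroup R[X]) (hS : ∀ f ∈ S, taylor 1 f ∈ S) (n : ℕ)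
    (h : ∀ c : R, ∃ g ∈ S, g.degree < ((n + 1 : ℕ) : WithBot ℕ) ∧ g.coeff n = c)
    (f : R[X]) (hf : f.degree < ((n + 1 : ℕ) : WithBot ℕ)) : f ∈ S := by
  induction n generalizing f with
  | zero =>
    obtain ⟨g, hg, hgd, hgc⟩ := h (f.coeff 0)
    rw [degree_lt_iff_coeff_zero] at hf hgd
    have hfg : f = g := by
      ext i
      rcases i with _ | i
      · exact hgc.symm
      · rw [hf _ (by omega), hgd _ (by omega)]
    rwa [hfg]
  | succ n ih =>
    obtain ⟨g, hg, hgd, hgc⟩ := h (f.coeff (n + 1))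
    have hlow : f - g ∈ S := by
      refine ih (fun c => ?_) _ ?_
      · obtain ⟨p, hp, hpd, hpc⟩ := h (algebraMap ℚ R ((n + 1 : ℚ)⁻¹) * c)
        refine ⟨taylor 1 p - p, S.sub_mem (hS p hp) hp, degree_taylor_one_sub_lt hpd, ?_⟩
        have hn : (n + 1 : ℚ) ≠ 0 := by positivity
        have hcast : (n + 1 : R) = algebraMap ℚ R (n + 1) := by simp
        rw [coeff_taylor_one_sub hpd, hpc, hcast, ← mul_assoc, ← map_mul, mul_inv_cancel₀ hn,
          map_one, one_mul]
      · rw [degree_lt_iff_coeff_zero] at hf hgd ⊢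
        intro m hm
        rw [coeff_sub]
        rcases hm.eq_or_lt with rfl | hm
        · rw [hgc, sub_self]
        · rw [hf m hm, hgd m hm, sub_self]
    simpa using S.add_mem hlow hg

/-- A proper translation invariant subspace of `ℂ[x]` has bounded degree. -/
lemma exists_le_degreeLT_of_taylor_mem (T : Submodule ℂ ℂ[X])
    (hT : ∀ f ∈ T, taylor 1 f ∈ T) (hne : T ≠ ⊤) : ∃ N, T ≤ degreeLT ℂ N := by
  by_contra! hunb
  refine hne (eq_top_iff.2 fun f _ => ?_)
  obtain ⟨g, hg, hgd⟩ := SetLike.not_le_iff_exists.1 (hunb (f.natDegree + 1))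
  rw [mem_degreeLT, not_lt] at hgd
  have hg0 : g ≠ 0 := by
    rintro rfl
    simp at hgd
  rw [degree_eq_natDegree hg0, Nat.cast_le] at hgd
  refine mem_of_degree_lt_of_coeff_surjective T.toAddSubgroup hT g.natDegree (fun c => ?_) f ?_
  · refine ⟨(c / g.leadingCoeff) • g, T.smul_mem _ hg, ?_, ?_⟩
    · refine (degree_smul_le _ _).trans_lt ?_
      rw [degree_eq_natDegree hg0]
      exact_mod_cast Nat.lt_succ_self _
    · rw [coeff_smul, smul_eq_mul, coeff_natDegree,
        div_mul_cancel₀ _ (leadingCoeff_ne_zero.2 hg0)]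
  · refine degree_le_natDegree.trans_lt ?_
    exact_mod_cast (by omega : f.natDegree < g.natDegree + 1)

lemma polyTranslate_zero_one (F : R2) : polyTranslate 0 1 F = taylor 1 F := by
  have hid : (aeval (X + C (0 : ℂ)) : ℂ[X] →ₐ[ℂ] ℂ[X]).toRingHom = RingHom.id _ := by
    ext <;> simp
  rw [polyTranslate, hid, map_id, taylor_apply, C_1]

lemma coeff_polyTranslate_one_zero (F : R2) (n : ℕ) :
    (polyTranslate 1 0 F).coeff n = taylor 1 (F.coeff n) := by
  simp [polyTranslate, taylor_apply, coeff_map, aeval_def, comp, algebraMap_eq]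

lemma degree_polyTranslate_le (a b : ℂ) (F : R2) : (polyTranslate a b F).degree ≤ F.degree := by
  rw [polyTranslate, ← taylor_apply, degree_taylor]
  exact degree_map_le

/-- The underlying linear subspace of a submodule of `ℂ[x,y]`. -/
def IsSubmodule.toSubmodule {M : Set R2} (hM : IsSubmodule M) : Submodule ℂ R2 where
  carrier := M
  zero_mem' := hM.1
  add_mem' ha hb := hM.2.1 _ ha _ hb
  smul_mem' c _ ha := hM.2.2.1 c _ ha

/-- The coordinates in degree `n` of a proper submodule of `{F | deg_y F < n + 1}` have
bounded degree. -/
lemma IsSubmodule.exists_degree_coeff_lt {A : Set R2} (hA : IsSubmodule A) {n : ℕ}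
    (hlt : A ⊂ {F : R2 | F.degree < ((n + 1 : ℕ) : WithBot ℕ)}) :
    ∃ N, ∀ F ∈ A, F.coeff n ∈ degreeLT ℂ N := by
  let T : Submodule ℂ ℂ[X] := hA.toSubmodule.map ((lcoeff ℂ[X] n).restrictScalars ℂ)
  have hT : ∀ f ∈ T, taylor 1 f ∈ T := by
    rintro _ ⟨F, hF, rfl⟩
    exact ⟨_, hA.2.2.2 F hF 1 0, coeff_polyTranslate_one_zero F n⟩
  have hne : T ≠ ⊤ := by
    intro htop
    refine hlt.2 fun F hF => mem_of_degree_lt_of_coeff_surjective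
      hA.toSubmodule.toAddSubgroup (fun G hG => ?_) n (fun c => ?_) F hF
    · rw [← polyTranslate_zero_one]
      exact hA.2.2.2 G hG 0 1
    · obtain ⟨G, hG, hGc⟩ : c ∈ T := htop ▸ Submodule.mem_top
      exact ⟨G, hG, hlt.1 hG, hGc⟩
  obtain ⟨N, hN⟩ := exists_le_degreeLT_of_taylor_mem T hT hne
  exact ⟨N, fun F hF => hN ⟨F, hF, rfl⟩⟩

lemma isLModule_degree_lt (d : ℕ) : IsLModule d {F : R2 | F.degree < (d : WithBot ℕ)} := by
  refine ⟨⟨?_, fun F hF G hG => ?_, fun c F hF => ?_, fun F hF a b => ?_⟩, fun F hF h => ?_⟩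
  · simp
  · exact (degree_add_le F G).trans_lt (max_lt hF hG)
  · exact (degree_smul_le c F).trans_lt hF
  · exact (degree_polyTranslate_le a b F).trans_lt hF
  · rw [Set.mem_ofPred_eq, degree_lt_iff_coeff_zero] at hF
    ext1 n
    rw [coeff_zero]
    rcases lt_or_ge n d with hn | hn
    · exact (smul_eq_zero.1 (h n hn)).resolve_left (by exact_mod_cast n.factorial_ne_zero)
    · exact hF n hn

/-- For `d ≥ 1`, the set `M_d^* = {F : deg_y F < d}` is an indecomposable L-module of
order `d` (in `R2 = ℂ[x][y]`, the degree in `y` is the outer degree). -/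
theorem stmt16 (d : ℕ) (hd : 1 ≤ d) :
    IsLModule d {F : R2 | F.degree < (d : WithBot ℕ)} ∧
      ¬ Decomposable {F : R2 | F.degree < (d : WithBot ℕ)} := by
  refine ⟨isLModule_degree_lt d, ?_⟩
  rintro ⟨k, A, -, hA, hsum⟩
  obtain ⟨n, rfl⟩ := Nat.exists_eq_add_of_le' hd
  choose N hN using fun i => (hA i).1.exists_degree_coeff_lt (hA i).2
  have hmem : (monomial n (X ^ ∑ i, N i) : R2) ∈
      {F : R2 | F.degree < ((n + 1 : ℕ) : WithBot ℕ)} :=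
    (degree_monomial_le _ _).trans_lt (by exact_mod_cast Nat.lt_succ_self n)
  rw [hsum, Set.mem_finsetSum] at hmem
  obtain ⟨g, hg, hgsum⟩ := hmem
  have hcoeff := congrArg (fun F : R2 => F.coeff n) hgsum
  simp only [finsetSum_coeff, coeff_monomial, if_true] at hcoeff
  have hdeg : (X ^ ∑ i, N i : ℂ[X]) ∈ degreeLT ℂ (∑ i, N i) := by
    rw [← hcoeff]
    exact Submodule.sum_mem _ fun i hi =>
      degreeLT_mono (Finset.single_le_sum (fun _ _ => Nat.zero_le _) hi)
        (hN i _ (hg (Finset.mem_univ i)))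
  rw [mem_degreeLT, degree_X_pow] at hdeg
  exact lt_irrefl _ hdeg
end
end

section
/- Let M be the set of all polynomials in ℂ[x,y,z] of the form ∑_{n=0}^{∞} (a_n·(x+y) + b_n)·z^n/n!, where a_n, b_n ∈ ℂ and a_n = b_n = 0 for all large n. Then M is a submodule of ℂ[x,y,z] and M is indecomposable: M cannot be written as the sum of finitely many proper submodules of M. -/
open scoped Pointwise BigOperators

noncomputable section

/-- The polynomial `x ↦ f(x + a)` in `ℂ[x_1,…,x_n]`. -/
noncomputable def mvTranslate {n : ℕ} (a : Fin n → ℂ) (f : MvPolynomial (Fin n) ℂ) :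
    MvPolynomial (Fin n) ℂ :=
  MvPolynomial.aeval (fun i => MvPolynomial.X i + MvPolynomial.C (a i)) f

/-- A submodule of `ℂ[x_1,…,x_n]`: a translation invariant `ℂ`-linear subspace. -/
def IsSubmoduleN {n : ℕ} (M : Set (MvPolynomial (Fin n) ℂ)) : Prop :=
  (0 ∈ M) ∧ (∀ f ∈ M, ∀ g ∈ M, f + g ∈ M) ∧ (∀ (c : ℂ), ∀ f ∈ M, c • f ∈ M) ∧
    (∀ f ∈ M, ∀ a : Fin n → ℂ, mvTranslate a f ∈ M)

/-- A submodule is decomposable if it is the sum of finitely many proper submodules of it. -/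
def DecomposableN {n : ℕ} (M : Set (MvPolynomial (Fin n) ℂ)) : Prop :=
  ∃ (k : ℕ) (A : Fin k → Set (MvPolynomial (Fin n) ℂ)), 0 < k ∧
    (∀ i, IsSubmoduleN (A i) ∧ A i ⊂ M) ∧ M = ∑ i : Fin k, A i

open Polynomial in
/-- A subspace of `ℂ[X]` stable under `p(X) ↦ p(X + 1)` which contains a nonzero polynomial `p`
contains every polynomial of degree at most `deg p`. -/
theorem mem_of_natDegree_le_of_taylor_mem (V : Submodule ℂ ℂ[X])
    (hV : ∀ p ∈ V, taylor 1 p ∈ V) (n : ℕ) :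
    ∀ p ∈ V, p ≠ 0 → p.natDegree = n → ∀ q : ℂ[X], q.natDegree ≤ n → q ∈ V := by
  induction n with
  | zero =>
    intro p hp hp0 hpn q hq
    rw [eq_C_of_natDegree_eq_zero hpn] at hp hp0
    rw [eq_C_of_natDegree_le_zero hq]
    have hc : p.coeff 0 ≠ 0 := by simpa using hp0
    have := V.smul_mem (q.coeff 0 / p.coeff 0) hp
    rwa [smul_C, smul_eq_mul, div_mul_cancel₀ _ hc] at this
  | succ n ih =>
    intro p hp hp0 hpn q hq
    have hlead : p.coeff (n + 1) ≠ 0 := by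
      rw [← hpn]; simpa using hp0
    have hcoeff : (taylor 1 p - p).coeff n = (n + 1) * p.coeff (n + 1) := by
      have hd : (hasseDeriv n p).natDegree < 2 := by
        have := natDegree_hasseDeriv_le p n
        omega
      rw [coeff_sub, taylor_coeff, eval_eq_sum_range' hd, Finset.sum_range_succ,
        Finset.sum_range_one, hasseDeriv_coeff, hasseDeriv_coeff]
      simp [add_comm 1 n]
    have hne : (taylor 1 p - p).coeff n ≠ 0 := by
      rw [hcoeff]
      exact mul_ne_zero (by exact_mod_cast n.succ_ne_zero) hlead
    have hdeg : (taylor 1 p - p).natDegree ≤ n := by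
      rw [natDegree_le_iff_coeff_eq_zero]
      intro m hm
      rcases (Nat.succ_le_of_lt hm).eq_or_lt with rfl | hm
      · have h := coeff_taylor_natDegree (r := (1 : ℂ)) (f := p)
        rw [hpn] at h
        rw [coeff_sub, Nat.succ_eq_add_one, h, leadingCoeff, hpn, sub_self]
      · rw [coeff_sub, coeff_eq_zero_of_natDegree_lt (by rw [natDegree_taylor]; omega),
          coeff_eq_zero_of_natDegree_lt (by omega), sub_self]
    have low := ih _ (V.sub_mem (hV p hp) hp) (fun h => hne (by rw [h, coeff_zero]))
      (le_antisymm hdeg (le_natDegree_of_ne_zero hne))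
    set c := q.coeff (n + 1) / p.coeff (n + 1) with hc
    have hq' : (q - c • p).natDegree ≤ n := by
      rw [natDegree_le_iff_coeff_eq_zero]
      intro m hm
      rcases (Nat.succ_le_of_lt hm).eq_or_lt with rfl | hm
      · rw [coeff_sub, coeff_smul, smul_eq_mul, hc, Nat.succ_eq_add_one,
          div_mul_cancel₀ _ hlead, sub_self]
      · rw [coeff_sub, coeff_smul, coeff_eq_zero_of_natDegree_lt (p := q) (by omega),
          coeff_eq_zero_of_natDegree_lt (p := p) (by omega), smul_zero, sub_self]
    simpa using V.add_mem (low _ hq') (V.smul_mem c hp)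

open MvPolynomial in
/-- The polynomial `p(z)(x + y) + q(z)`. -/
def linearInSum (p q : Polynomial ℂ) : MvPolynomial (Fin 3) ℂ :=
  Polynomial.aeval (X 2) p * (X 0 + X 1) + Polynomial.aeval (X 2) q

/-- `F ↦ F(0, 0, X)`. -/
def constPart : MvPolynomial (Fin 3) ℂ →ₗ[ℂ] Polynomial ℂ :=
  (MvPolynomial.aeval ![0, 0, Polynomial.X]).toLinearMap

/-- `F ↦ F(1, 0, X) - F(0, 0, X)`. -/
def slopePart : MvPolynomial (Fin 3) ℂ →ₗ[ℂ] Polynomial ℂ :=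
  (MvPolynomial.aeval ![1, 0, Polynomial.X]).toLinearMap - constPart

theorem aeval_polynomial_aeval_X_two (v : Fin 3 → Polynomial ℂ) (p : Polynomial ℂ) :
    MvPolynomial.aeval v (Polynomial.aeval (MvPolynomial.X 2 : MvPolynomial (Fin 3) ℂ) p) =
      Polynomial.aeval (v 2) p := by
  rw [← Polynomial.aeval_algHom_apply, MvPolynomial.aeval_X]

theorem constPart_linearInSum (p q : Polynomial ℂ) : constPart (linearInSum p q) = q := by
  simp [constPart, linearInSum, aeval_polynomial_aeval_X_two]

theorem slopePart_linearInSum (p q : Polynomial ℂ) : slopePart (linearInSum p q) = p := by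
  simp [slopePart, constPart, linearInSum, aeval_polynomial_aeval_X_two]

theorem linearInSum_add (p q p' q' : Polynomial ℂ) :
    linearInSum p q + linearInSum p' q' = linearInSum (p + p') (q + q') := by
  simp only [linearInSum, map_add]
  ring

theorem smul_linearInSum (c : ℂ) (p q : Polynomial ℂ) :
    c • linearInSum p q = linearInSum (c • p) (c • q) := by
  simp only [linearInSum, map_smul, smul_add, smul_mul_assoc]

theorem mvTranslate_aeval_X_two (a : Fin 3 → ℂ) (p : Polynomial ℂ) :
    mvTranslate a (Polynomial.aeval (MvPolynomial.X 2) p) =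
      Polynomial.aeval (MvPolynomial.X 2) (Polynomial.taylor (a 2) p) := by
  rw [mvTranslate, ← Polynomial.aeval_algHom_apply, MvPolynomial.aeval_X, Polynomial.taylor_apply,
    Polynomial.aeval_comp]
  simp [MvPolynomial.algebraMap_eq]

theorem mvTranslate_linearInSum (a : Fin 3 → ℂ) (p q : Polynomial ℂ) :
    mvTranslate a (linearInSum p q) = linearInSum (Polynomial.taylor (a 2) p)
      (Polynomial.taylor (a 2) q + Polynomial.C (a 0 + a 1) * Polynomial.taylor (a 2) p) := by
  have hp := mvTranslate_aeval_X_two a p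
  have hq := mvTranslate_aeval_X_two a q
  unfold mvTranslate at hp hq
  simp only [mvTranslate, linearInSum, map_add, map_mul, hp, hq, MvPolynomial.aeval_X,
    Polynomial.aeval_C, MvPolynomial.algebraMap_eq]
  ring

/-- The set of all polynomials `p(z)(x + y) + q(z)`. -/
def linearInSumSet : Set (MvPolynomial (Fin 3) ℂ) := {F | ∃ p q, F = linearInSum p q}

theorem isSubmoduleN_linearInSumSet : IsSubmoduleN linearInSumSet := by
  refine ⟨⟨0, 0, by simp [linearInSum]⟩, ?_, ?_, ?_⟩
  · rintro _ ⟨p, q, rfl⟩ _ ⟨p', q', rfl⟩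
    exact ⟨_, _, linearInSum_add ..⟩
  · rintro c _ ⟨p, q, rfl⟩
    exact ⟨_, _, smul_linearInSum ..⟩
  · rintro _ ⟨p, q, rfl⟩ a
    exact ⟨_, _, mvTranslate_linearInSum ..⟩

/-- The polynomials `p` occurring in the elements `p(z)(x + y) + q(z)` of a proper submodule have
bounded degree. -/
theorem exists_natDegree_slopePart_le {A : Set (MvPolynomial (Fin 3) ℂ)} (hA : IsSubmoduleN A)
    (hlt : A ⊂ linearInSumSet) : ∃ N, ∀ f ∈ A, (slopePart f).natDegree ≤ N := by
  by_contra! hunb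
  obtain ⟨h0, hadd, hsmul, htr⟩ := hA
  let S : Submodule ℂ (MvPolynomial (Fin 3) ℂ) :=
    { carrier := A
      zero_mem' := h0
      add_mem' := fun {f g} hf hg => hadd f hf g hg
      smul_mem' := hsmul }
  have hW (p : Polynomial ℂ) : p ∈ S.map slopePart := by
    obtain ⟨f, hf, hdeg⟩ := hunb p.natDegree
    refine mem_of_natDegree_le_of_taylor_mem (S.map slopePart) ?_ _ (slopePart f)
      (Submodule.mem_map_of_mem hf) ?_ rfl p hdeg.le
    · rintro _ ⟨g, hg, rfl⟩
      obtain ⟨p', q', rfl⟩ := hlt.1 hg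
      refine ⟨_, htr _ hg ![0, 0, 1], ?_⟩
      simp only [mvTranslate_linearInSum, slopePart_linearInSum]
      simp
    · intro h
      simp [h] at hdeg
  have hconst (p : Polynomial ℂ) : linearInSum 0 p ∈ S := by
    obtain ⟨g, hg, rfl⟩ := hW p
    obtain ⟨p', q', rfl⟩ := hlt.1 hg
    have h : mvTranslate ![1, 0, 0] (linearInSum p' q') - linearInSum p' q' ∈ S :=
      S.sub_mem (htr _ hg _) hg
    convert h using 1
    rw [eq_sub_iff_add_eq, linearInSum_add, mvTranslate_linearInSum, slopePart_linearInSum]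
    simp [add_comm]
  refine hlt.2 ?_
  rintro _ ⟨p, q, rfl⟩
  obtain ⟨g, hg, rfl⟩ := hW p
  obtain ⟨p', q', rfl⟩ := hlt.1 hg
  have h := S.add_mem (hconst (q - q')) hg
  rw [linearInSum_add, zero_add, sub_add_cancel] at h
  rwa [slopePart_linearInSum]

theorem not_decomposableN_linearInSumSet : ¬ DecomposableN linearInSumSet := by
  rintro ⟨k, A, -, hA, hsum⟩
  choose N hN using fun i => exists_natDegree_slopePart_le (hA i).1 (hA i).2
  have hmem : linearInSum (Polynomial.X ^ (Finset.univ.sup N + 1)) 0 ∈ linearInSumSet :=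
    ⟨_, _, rfl⟩
  rw [hsum, Set.mem_fintype_sum] at hmem
  obtain ⟨g, hg, hgsum⟩ := hmem
  have h := congrArg (fun f => (slopePart f).natDegree) hgsum
  simp only [map_sum, slopePart_linearInSum, Polynomial.natDegree_X_pow] at h
  have hle := Polynomial.natDegree_sum_le_of_forall_le Finset.univ (fun i => slopePart (g i))
    (n := Finset.univ.sup N) fun i hi => (hN i _ (hg i)).trans (Finset.le_sup hi)
  omega

open MvPolynomial in
theorem setOf_sum_eq_linearInSumSet :
    {F : MvPolynomial (Fin 3) ℂ | ∃ (N : ℕ) (a b : ℕ → ℂ),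
        F = ∑ n ∈ Finset.range N,
          (C (a n) * (X 0 + X 1) + C (b n)) * C ((n.factorial : ℂ)⁻¹) * X 2 ^ n} =
      linearInSumSet := by
  ext F
  constructor
  · rintro ⟨N, a, b, rfl⟩
    refine ⟨∑ n ∈ Finset.range N, Polynomial.C (a n * (n.factorial : ℂ)⁻¹) * Polynomial.X ^ n,
      ∑ n ∈ Finset.range N, Polynomial.C (b n * (n.factorial : ℂ)⁻¹) * Polynomial.X ^ n, ?_⟩
    simp only [linearInSum, map_sum, map_mul, map_pow, Polynomial.aeval_X, Polynomial.aeval_C,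
      algebraMap_eq, Finset.sum_mul, ← Finset.sum_add_distrib]
    exact Finset.sum_congr rfl fun n _ => by ring
  · rintro ⟨p, q, rfl⟩
    refine ⟨max p.natDegree q.natDegree + 1, fun n => p.coeff n * n.factorial,
      fun n => q.coeff n * n.factorial, ?_⟩
    rw [linearInSum, Polynomial.aeval_eq_sum_range' (Nat.lt_succ_of_le (le_max_left _ _)),
      Polynomial.aeval_eq_sum_range' (Nat.lt_succ_of_le (le_max_right _ _)), Finset.sum_mul,
      ← Finset.sum_add_distrib]
    refine Finset.sum_congr rfl fun n _ => ?_
    have hn : (C (n.factorial : ℂ) : MvPolynomial (Fin 3) ℂ) * C ((n.factorial : ℂ)⁻¹) = 1 := by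
      rw [← C_mul, mul_inv_cancel₀ (by exact_mod_cast n.factorial_ne_zero), C_1]
    simp only [smul_eq_C_mul, C_mul]
    linear_combination
      -(C (p.coeff n) * (X 0 + X 1) + C (q.coeff n)) * X 2 ^ n * hn

open MvPolynomial in
/-- Remark 2 of the paper: the set of polynomials `∑ₙ (aₙ(x+y) + bₙ)·zⁿ/n!` is an
indecomposable submodule of `ℂ[x,y,z]`. -/
theorem stmt18 :
    IsSubmoduleN {F : MvPolynomial (Fin 3) ℂ | ∃ (N : ℕ) (a b : ℕ → ℂ),
        F = ∑ n ∈ Finset.range N,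
          (C (a n) * (X 0 + X 1) + C (b n)) * C ((n.factorial : ℂ)⁻¹) * X 2 ^ n} ∧
      ¬ DecomposableN {F : MvPolynomial (Fin 3) ℂ | ∃ (N : ℕ) (a b : ℕ → ℂ),
        F = ∑ n ∈ Finset.range N,
          (C (a n) * (X 0 + X 1) + C (b n)) * C ((n.factorial : ℂ)⁻¹) * X 2 ^ n} := by
  rw [setOf_sum_eq_linearInSumSet]
  exact ⟨isSubmoduleN_linearInSumSet, not_decomposableN_linearInSumSet⟩
end
end

section
/- Let M be an L-module of order s in ℂ[x,y]. Then for every F ∈ M and every n ≥ 0, deg [F]_n ≤ max_{0 ≤ i ≤ s−1} deg [F]_i, where deg denotes the degree in x and the zero polynomial has degree −∞. Moreover, M ∩ ℂ[y] = {f ∈ ℂ[y] : deg f < r} for some integer r with 0 ≤ r ≤ s. -/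
open Polynomial
open scoped Pointwise BigOperators

noncomputable section

theorem WithBot.le_natCast_of_lt_natCast_succ {n : WithBot ℕ} {m : ℕ}
    (h : n < ((m + 1 : ℕ) : WithBot ℕ)) : n ≤ (m : WithBot ℕ) := by
  cases n with
  | bot => exact bot_le
  | coe n => exact WithBot.coe_le_coe.mpr (Nat.le_of_lt_succ (WithBot.coe_lt_coe.mp h))

/-- The forward difference operator lowers degrees by one. -/
theorem degree_taylor_one_sub_self {f : Polynomial ℂ} {m : ℕ} (hf : f.degree = (m + 1 : ℕ)) :
    (taylor 1 f - f).degree = (m : ℕ) := by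
  have hn : f.natDegree = m + 1 := natDegree_eq_of_degree_eq_some hf
  have hlc : f.coeff (m + 1) ≠ 0 := by
    rw [← hn, coeff_natDegree, leadingCoeff_ne_zero]
    rintro rfl
    simp at hn
  have hco : (taylor 1 f).coeff m = f.coeff m + (m + 1) * f.coeff (m + 1) := by
    have hd : (hasseDeriv m f).natDegree < 2 := by
      have := natDegree_hasseDeriv_le f m
      omega
    rw [taylor_coeff, eval_eq_sum_range' hd, Finset.sum_range_succ, Finset.sum_range_one]
    simp [hasseDeriv_coeff, add_comm 1 m]
  apply le_antisymm
  · have hne : taylor 1 f ≠ 0 := by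
      rw [← degree_ne_bot, degree_taylor, hf]
      exact WithBot.coe_ne_bot
    have hlt : (taylor 1 f - f).degree < (taylor 1 f).degree :=
      degree_sub_lt_left (degree_taylor f 1) hne (leadingCoeff_taylor 1 f)
    rw [degree_taylor, hf] at hlt
    exact WithBot.le_natCast_of_lt_natCast_succ hlt
  · apply le_degree_of_ne_zero
    rw [coeff_sub, hco, add_sub_cancel_left]
    exact mul_ne_zero (by exact_mod_cast Nat.succ_ne_zero m) hlc

theorem degree_taylor_one_sub_self_lt_iff {f : Polynomial ℂ} {d : ℕ} :
    (taylor 1 f - f).degree < (d : WithBot ℕ) ↔ f.degree < ((d + 1 : ℕ) : WithBot ℕ) := by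
  rcases hf : f.degree with _ | k
  · rw [show f = 0 from degree_eq_bot.mp hf]
    rw [map_zero, sub_zero, degree_zero]
    exact ⟨fun _ => WithBot.bot_lt_coe _, fun _ => WithBot.bot_lt_coe _⟩
  · rcases k with _ | m
    · obtain ⟨c, rfl⟩ : ∃ c, f = C c := ⟨_, eq_C_of_degree_le_zero hf.le⟩
      simp only [taylor_C, sub_self, degree_zero]
      exact ⟨fun _ => WithBot.coe_lt_coe.mpr (Nat.succ_pos d), fun _ => WithBot.bot_lt_coe _⟩
    · rw [degree_taylor_one_sub_self hf]
      exact ⟨fun h => WithBot.coe_lt_coe.mpr (Nat.succ_lt_succ (WithBot.coe_lt_coe.mp h)),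
        fun h => WithBot.coe_lt_coe.mpr (Nat.lt_of_succ_lt_succ (WithBot.coe_lt_coe.mp h))⟩

theorem coordPoly_polyTranslate_zero_right (a : ℂ) (F : R2) (n : ℕ) :
    coordPoly (polyTranslate a 0 F) n = taylor a (coordPoly F n) := by
  rw [coordPoly, coordPoly, polyTranslate, map_smul, C_0, C_0, add_zero, comp_X, coeff_map]
  simp [taylor_apply, comp, aeval_def, algebraMap_eq]

theorem polyTranslate_zero_left_map_C (b : ℂ) (g : Polynomial ℂ) :
    polyTranslate 0 b (g.map C) = (taylor b g).map C := by
  have h : (aeval (X + C 0) : Polynomial ℂ →ₐ[ℂ] Polynomial ℂ).toRingHom = RingHom.id _ := by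
    ext <;> simp
  rw [polyTranslate, h, map_id, taylor_apply, map_comp]
  simp

theorem IsSubmodule.sub_mem {M : Set R2} (hM : IsSubmodule M) {F G : R2} (hF : F ∈ M)
    (hG : G ∈ M) : F - G ∈ M := by
  have h := hM.2.1 F hF _ (hM.2.2.1 (-1) G hG)
  rwa [neg_one_smul, ← sub_eq_add_neg] at h

theorem IsLModule.degree_coordPoly_lt {s : ℕ} {M : Set R2} (hM : IsLModule s M) (d : ℕ) :
    ∀ F ∈ M, (∀ i < s, (coordPoly F i).degree < (d : WithBot ℕ)) →
      ∀ n, (coordPoly F n).degree < (d : WithBot ℕ) := by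
  induction d with
  | zero =>
    intro F hF h n
    rw [hM.2 F hF fun i hi => by simpa using h i hi]
    simp [coordPoly]
  | succ d ih =>
    intro F hF h n
    have hco (i : ℕ) : coordPoly (polyTranslate 1 0 F - F) i =
        taylor 1 (coordPoly F i) - coordPoly F i := by
      rw [← coordPoly_polyTranslate_zero_right]
      simp [coordPoly, smul_sub]
    have key := ih _ (hM.1.sub_mem (hM.1.2.2.2 F hF 1 0) hF) (fun i hi => by
      rw [hco, degree_taylor_one_sub_self_lt_iff]
      exact h i hi) n
    rwa [hco, degree_taylor_one_sub_self_lt_iff] at key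

theorem IsSubmodule.map_C_mem_of_degree_le {M : Set R2} (hM : IsSubmodule M) (m : ℕ) :
    ∀ g : Polynomial ℂ, g.map C ∈ M → g.degree = (m : ℕ) →
      ∀ h : Polynomial ℂ, h.degree ≤ (m : ℕ) → h.map C ∈ M := by
  have hsmul (c : ℂ) (g : Polynomial ℂ) (hg : g.map C ∈ M) : (c • g).map C ∈ M := by
    have := hM.2.2.1 c _ hg
    convert this using 1
    ext; simp
  induction m with
  | zero =>
    intro g hg hd h hh
    obtain ⟨c, rfl⟩ : ∃ c, g = C c := ⟨_, eq_C_of_degree_le_zero hd.le⟩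
    obtain ⟨e, rfl⟩ : ∃ e, h = C e := ⟨_, eq_C_of_degree_le_zero hh⟩
    have hc : c ≠ 0 := by
      rintro rfl
      simp at hd
    have := hsmul (e / c) _ hg
    rwa [smul_C, smul_eq_mul, div_mul_cancel₀ _ hc] at this
  | succ m ih =>
    intro g hg hd h hh
    have hΔ : (taylor 1 g - g).map C ∈ M := by
      rw [Polynomial.map_sub, ← polyTranslate_zero_left_map_C]
      exact hM.sub_mem (hM.2.2.2 _ hg 0 1) hg
    have hlc : g.coeff (m + 1) ≠ 0 := coeff_ne_zero_of_eq_degree hd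
    set c := h.coeff (m + 1) / g.coeff (m + 1) with hc
    have hlow : (h - c • g).degree ≤ (m : ℕ) := by
      rw [degree_le_iff_coeff_zero]
      intro k hk
      have hk : m < k := by exact_mod_cast hk
      rcases eq_or_lt_of_le (Nat.succ_le_of_lt hk) with rfl | hk'
      · simp [hc, div_mul_cancel₀ _ hlc]
      · have hk'' : ((m + 1 : ℕ) : WithBot ℕ) < k := by exact_mod_cast hk'
        simp [coeff_eq_zero_of_degree_lt (hh.trans_lt hk''),
          coeff_eq_zero_of_degree_lt (hd.trans_lt hk'')]
    have h1 := ih _ hΔ (degree_taylor_one_sub_self hd) _ hlow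
    have h2 := hM.2.1 _ h1 _ (hsmul c g hg)
    rwa [← Polynomial.map_add, sub_add_cancel] at h2

theorem IsLModule.degree_lt_of_map_C_mem {s : ℕ} {M : Set R2} (hM : IsLModule s M)
    {g : Polynomial ℂ} (hg : g.map C ∈ M) : g.degree < (s : WithBot ℕ) := by
  by_contra! hlt
  have hd : g.degree = g.natDegree := degree_eq_natDegree (by rintro rfl; simp at hlt)
  have hs : s ≤ g.natDegree := by
    rw [hd] at hlt
    exact_mod_cast hlt
  have hX := hM.1.map_C_mem_of_degree_le _ g hg hd (X ^ g.natDegree) (degree_X_pow_le _)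
  have h0 := hM.2 _ hX fun i hi => by
    simp [coordPoly, coeff_X_pow, (hi.trans_le hs).ne]
  simp at h0

/-- If `M` is an L-module of order `s`, then `deg_x [F]_n ≤ max_{i<s} deg_x [F]_i` for all
`F ∈ M`, `n ≥ 0`; moreover `M ∩ ℂ[y] = {f ∈ ℂ[y] : deg f < r}` for some `0 ≤ r ≤ s`.
(`ℂ[y]` sits inside `R2 = ℂ[x][y]` as the polynomials with constant coefficients, i.e. the
image of `Polynomial.map C`.) -/
theorem stmt19 (s : ℕ) (hs : 0 < s) (M : Set R2) (hM : IsLModule s M) :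
    (∀ F ∈ M, ∀ n : ℕ,
      (coordPoly F n).degree ≤ (Finset.range s).sup fun i => (coordPoly F i).degree) ∧
    ∃ r : ℕ, r ≤ s ∧
      M ∩ Set.range (Polynomial.map (Polynomial.C : ℂ →+* Polynomial ℂ)) =
        (fun g : Polynomial ℂ => g.map (Polynomial.C : ℂ →+* Polynomial ℂ)) ''
          {g : Polynomial ℂ | g.degree < (r : WithBot ℕ)} := by
  constructor
  · intro F hF n
    rcases hd : (Finset.range s).sup fun i => (coordPoly F i).degree with _ | k
    · have h := hM.degree_coordPoly_lt 0 F hF (fun i hi => by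
        have := Finset.le_sup (f := fun i => (coordPoly F i).degree) (Finset.mem_range.mpr hi)
        rw [hd] at this
        exact this.trans_lt (WithBot.bot_lt_coe _)) n
      exact (degree_eq_bot.mpr (by simpa using h)).le
    · have h := hM.degree_coordPoly_lt (k + 1) F hF (fun i hi => by
        have := Finset.le_sup (f := fun i => (coordPoly F i).degree) (Finset.mem_range.mpr hi)
        rw [hd] at this
        exact this.trans_lt (WithBot.coe_lt_coe.mpr k.lt_succ_self)) n
      exact WithBot.le_natCast_of_lt_natCast_succ h
  · classical
    have hex : ∃ r : ℕ, ∀ g : Polynomial ℂ, g.map C ∈ M → g.degree < (r : WithBot ℕ) :=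
      ⟨s, fun g hg => hM.degree_lt_of_map_C_mem hg⟩
    refine ⟨Nat.find hex, Nat.find_min' hex fun g hg => hM.degree_lt_of_map_C_mem hg, ?_⟩
    have hspec := Nat.find_spec hex
    ext F
    constructor
    · rintro ⟨hF, g, rfl⟩
      exact ⟨g, hspec g hF, rfl⟩
    · rintro ⟨h, hh, rfl⟩
      refine ⟨?_, h, rfl⟩
      replace hh : h.degree < (Nat.find hex : WithBot ℕ) := hh
      rcases hr : Nat.find hex with _ | r
      · rw [hr] at hh
        have h0 : h = 0 := by simpa using hh
        simpa [h0] using hM.1.1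
      · have hmin := Nat.find_min hex (m := r) (by omega)
        push Not at hmin
        obtain ⟨g, hg, hgr⟩ := hmin
        have hlt := hspec g hg
        rw [hr] at hlt hh
        have hle {f : Polynomial ℂ} (hf : f.degree < ((r + 1 : ℕ) : WithBot ℕ)) :
            f.degree ≤ (r : ℕ) := WithBot.le_natCast_of_lt_natCast_succ hf
        exact hM.1.map_C_mem_of_degree_le r g hg (le_antisymm (hle hlt) hgr) h (hle hh)
end
end
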